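/- Let A be an enriched matrix. Among any three LR-rows of A, some two are nested, if and only if A contains none of D_11, D_12, D_13 as a subconfiguration. -/

import Mathlib

/-- Labels for rows of an enriched matrix. -/
inductive RowLabel : Type
  | L | R | LR
deriving DecidableEq

/-- Colors for rows/blocks of an enriched matrix. -/
inductive RowColor : Type
  | red | blue
deriving DecidableEq

/-- An enriched matrix: a (0,1)-matrix whose rows may carry an optional label in
{L, R, LR} and an optional color in {red, blue}, where only L-rows, R-rows and
all-zero LR-rows may be colored, and all colored all-zero LR-rows have the same
color. -/
structure EnrichedMatrix (m n : ℕ) : Type where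
  entry : Fin m → Fin n → Bool
  label : Fin m → Option RowLabel
  color : Fin m → Option RowColor
  color_rows : ∀ i, (color i).isSome = true →
    label i = some RowLabel.L ∨ label i = some RowLabel.R ∨
      (label i = some RowLabel.LR ∧ ∀ j, entry i j = false)
  lr_color_unique : ∀ i k, label i = some RowLabel.LR → label k = some RowLabel.LR →
    (color i).isSome = true → (color k).isSome = true → color i = color k

namespace EnrichedMatrix

variable {m n : ℕ} (A : EnrichedMatrix m n)

/-- Two rows are disjoint: they share no 1-column. -/
def RowDisj (i k : Fin m) : Prop := ∀ j, ¬(A.entry i j = true ∧ A.entry k j = true)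

/-- Row `i` is contained in row `k`. -/
def RowLe (i k : Fin m) : Prop := ∀ j, A.entry i j = true → A.entry k j = true

/-- Two rows are nested: one is contained in the other. -/
def RowNested (i k : Fin m) : Prop := A.RowLe i k ∨ A.RowLe k i

/-- A row is nonempty: it has at least one 1. -/
def RowNonempty (i : Fin m) : Prop := ∃ j, A.entry i j = true

/-- Rows `i` and `k` are both colored, with the same color. -/
def SameColor (i k : Fin m) : Prop := ∃ c, A.color i = some c ∧ A.color k = some c

/-- Rows `i` and `k` are both colored, with distinct colors. -/
def DistinctColors (i k : Fin m) : Prop :=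
  ∃ c d, A.color i = some c ∧ A.color k = some d ∧ c ≠ d

end EnrichedMatrix

namespace EnrichedMatrix

/-- `A` contains `D_11` as a subconfiguration: three uncolored LR-rows inducing the
pattern 100 / 010 / 001. -/
def ContainsD11 {m n : ℕ} (A : EnrichedMatrix m n) : Prop :=
  ∃ (a b c : Fin m) (j₁ j₂ j₃ : Fin n), a ≠ b ∧ a ≠ c ∧ b ≠ c ∧
    j₁ ≠ j₂ ∧ j₁ ≠ j₃ ∧ j₂ ≠ j₃ ∧
    A.label a = some RowLabel.LR ∧ A.color a = none ∧
    A.label b = some RowLabel.LR ∧ A.color b = none ∧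
    A.label c = some RowLabel.LR ∧ A.color c = none ∧
    A.entry a j₁ = true ∧ A.entry a j₂ = false ∧ A.entry a j₃ = false ∧
    A.entry b j₁ = false ∧ A.entry b j₂ = true ∧ A.entry b j₃ = false ∧
    A.entry c j₁ = false ∧ A.entry c j₂ = false ∧ A.entry c j₃ = true

/-- `A` contains `D_12` as a subconfiguration: three uncolored LR-rows inducing the
pattern 101 / 110 / 011. -/
def ContainsD12 {m n : ℕ} (A : EnrichedMatrix m n) : Prop :=
  ∃ (a b c : Fin m) (j₁ j₂ j₃ : Fin n), a ≠ b ∧ a ≠ c ∧ b ≠ c ∧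
    j₁ ≠ j₂ ∧ j₁ ≠ j₃ ∧ j₂ ≠ j₃ ∧
    A.label a = some RowLabel.LR ∧ A.color a = none ∧
    A.label b = some RowLabel.LR ∧ A.color b = none ∧
    A.label c = some RowLabel.LR ∧ A.color c = none ∧
    A.entry a j₁ = true ∧ A.entry a j₂ = false ∧ A.entry a j₃ = true ∧
    A.entry b j₁ = true ∧ A.entry b j₂ = true ∧ A.entry b j₃ = false ∧
    A.entry c j₁ = false ∧ A.entry c j₂ = true ∧ A.entry c j₃ = true

/-- `A` contains `D_13` as a subconfiguration: three uncolored LR-rows inducing the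
pattern 1100 / 0110 / 0011. -/
def ContainsD13 {m n : ℕ} (A : EnrichedMatrix m n) : Prop :=
  ∃ (a b c : Fin m) (j₁ j₂ j₃ j₄ : Fin n), a ≠ b ∧ a ≠ c ∧ b ≠ c ∧
    j₁ ≠ j₂ ∧ j₁ ≠ j₃ ∧ j₁ ≠ j₄ ∧ j₂ ≠ j₃ ∧ j₂ ≠ j₄ ∧ j₃ ≠ j₄ ∧
    A.label a = some RowLabel.LR ∧ A.color a = none ∧
    A.label b = some RowLabel.LR ∧ A.color b = none ∧
    A.label c = some RowLabel.LR ∧ A.color c = none ∧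
    A.entry a j₁ = true ∧ A.entry a j₂ = true ∧ A.entry a j₃ = false ∧ A.entry a j₄ = false ∧
    A.entry b j₁ = false ∧ A.entry b j₂ = true ∧ A.entry b j₃ = true ∧ A.entry b j₄ = false ∧
    A.entry c j₁ = false ∧ A.entry c j₂ = false ∧ A.entry c j₃ = true ∧ A.entry c j₄ = true

end EnrichedMatrix

namespace EnrichedMatrix

variable {m n : ℕ} {A : EnrichedMatrix m n}

theorem not_rowLe_iff {i k : Fin m} :
    ¬ A.RowLe i k ↔ ∃ j, A.entry i j = true ∧ A.entry k j = false := by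
  simp [RowLe]

theorem not_rowNested_of_entry {i k : Fin m} {j l : Fin n}
    (hij : A.entry i j = true) (hkj : A.entry k j = false)
    (hil : A.entry i l = false) (hkl : A.entry k l = true) : ¬ A.RowNested i k := by
  rintro (h | h)
  · simp [h j hij] at hkj
  · simp [h l hkl] at hil

theorem color_eq_none_of_entry {i : Fin m} {j : Fin n}
    (hi : A.label i = some RowLabel.LR) (hij : A.entry i j = true) : A.color i = none := by
  by_contra h
  rcases A.color_rows i (Option.isSome_iff_ne_none.2 h) with h | h | ⟨-, h⟩
  · simp [hi] at h
  · simp [hi] at h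
  · simp [h j] at hij

/-- Three pairwise non-nested LR-rows `a`, `b`, `c` form a `D_13` as soon as no column belongs
to `b` alone and no column belongs to `a` and `c` but not to `b`. -/
theorem containsD13_of_not_rowNested {a b c : Fin m}
    (ha : A.label a = some RowLabel.LR) (hb : A.label b = some RowLabel.LR)
    (hc : A.label c = some RowLabel.LR)
    (hab : ¬ A.RowNested a b) (hac : ¬ A.RowNested a c) (hbc : ¬ A.RowNested b c)
    (h₁ : ∀ j, ¬ (A.entry a j = false ∧ A.entry b j = true ∧ A.entry c j = false))
    (h₂ : ∀ j, ¬ (A.entry a j = true ∧ A.entry b j = false ∧ A.entry c j = true)) :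
    A.ContainsD13 := by
  have hab' : a ≠ b := by rintro rfl; exact hab (.inl fun _ h => h)
  have hac' : a ≠ c := by rintro rfl; exact hac (.inl fun _ h => h)
  have hbc' : b ≠ c := by rintro rfl; exact hbc (.inl fun _ h => h)
  simp only [RowNested, not_or, not_rowLe_iff] at hab hbc
  obtain ⟨⟨j₁, a₁, b₁⟩, ⟨j₃, b₃, a₃⟩⟩ := hab
  obtain ⟨⟨j₂, b₂, c₂⟩, ⟨j₄, c₄, b₄⟩⟩ := hbc
  have c₁ : A.entry c j₁ = false := by specialize h₂ j₁; simp_all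
  have c₃ : A.entry c j₃ = true := by specialize h₁ j₃; simp_all
  have a₂ : A.entry a j₂ = true := by specialize h₁ j₂; simp_all
  have a₄ : A.entry a j₄ = false := by specialize h₂ j₄; simp_all
  refine ⟨a, b, c, j₁, j₂, j₃, j₄, hab', hac', hbc', ?_, ?_, ?_, ?_, ?_, ?_,
    ha, color_eq_none_of_entry ha a₁, hb, color_eq_none_of_entry hb b₂,
    hc, color_eq_none_of_entry hc c₃, a₁, a₂, a₃, a₄, b₁, b₂, b₃, b₄, c₁, c₂, c₃, c₄⟩ <;>
  · rintro rfl
    simp_all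

/-- Three pairwise non-nested LR-rows contain one of `D_11`, `D_12`, `D_13`. -/
theorem containsD11_or_containsD12_or_containsD13 {a b c : Fin m}
    (ha : A.label a = some RowLabel.LR) (hb : A.label b = some RowLabel.LR)
    (hc : A.label c = some RowLabel.LR)
    (hab : ¬ A.RowNested a b) (hac : ¬ A.RowNested a c) (hbc : ¬ A.RowNested b c) :
    A.ContainsD11 ∨ A.ContainsD12 ∨ A.ContainsD13 := by
  have symm {i k : Fin m} (h : ¬ A.RowNested i k) : ¬ A.RowNested k i := fun h' => h h'.symm
  have ne {i k : Fin m} (h : ¬ A.RowNested i k) : i ≠ k := by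
    rintro rfl; exact h (.inl fun _ h => h)
  have single {x y z : Fin m} (hxy : ¬ A.RowNested x y) (hzy : ¬ A.RowNested z y)
      (h : ∀ j, ¬ (A.entry x j = false ∧ A.entry y j = true ∧ A.entry z j = false)) :
      (∃ j, A.entry x j = true ∧ A.entry y j = true ∧ A.entry z j = false) ∧
        ∃ j, A.entry x j = false ∧ A.entry y j = true ∧ A.entry z j = true := by
    simp only [RowNested, not_or, not_rowLe_iff] at hxy hzy
    obtain ⟨-, j, yj, xj⟩ := hxy
    obtain ⟨-, l, yl, zl⟩ := hzy
    exact ⟨⟨l, by specialize h l; simp_all⟩, ⟨j, by specialize h j; simp_all⟩⟩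
  have key {x y z : Fin m} (hx : A.label x = some RowLabel.LR)
      (hy : A.label y = some RowLabel.LR) (hz : A.label z = some RowLabel.LR)
      (hxy : ¬ A.RowNested x y) (hxz : ¬ A.RowNested x z) (hyz : ¬ A.RowNested y z)
      (h : ∀ j, ¬ (A.entry x j = false ∧ A.entry y j = true ∧ A.entry z j = false)) :
      A.ContainsD12 ∨ A.ContainsD13 := by
    by_cases h₂ : ∃ j, A.entry x j = true ∧ A.entry y j = false ∧ A.entry z j = true
    · obtain ⟨j₃, x₃, y₃, z₃⟩ := h₂
      obtain ⟨⟨j₁, x₁, y₁, z₁⟩, ⟨j₂, x₂, y₂, z₂⟩⟩ := single hxy (symm hyz) h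
      refine .inl ⟨x, y, z, j₁, j₂, j₃, ne hxy, ne hxz, ne hyz, ?_, ?_, ?_,
        hx, color_eq_none_of_entry hx x₁, hy, color_eq_none_of_entry hy y₁,
        hz, color_eq_none_of_entry hz z₂, x₁, x₂, x₃, y₁, y₂, y₃, z₁, z₂, z₃⟩ <;>
      · rintro rfl
        simp_all
    · exact .inr (containsD13_of_not_rowNested hx hy hz hxy hxz hyz h (not_exists.1 h₂))
  by_cases h₁ : ∃ j, A.entry b j = false ∧ A.entry a j = true ∧ A.entry c j = false
  swap
  · exact .inr (key hb ha hc (symm hab) hbc hac (not_exists.1 h₁))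
  by_cases h₂ : ∃ j, A.entry a j = false ∧ A.entry b j = true ∧ A.entry c j = false
  swap
  · exact .inr (key ha hb hc hab hac hbc (not_exists.1 h₂))
  by_cases h₃ : ∃ j, A.entry a j = false ∧ A.entry c j = true ∧ A.entry b j = false
  swap
  · exact .inr (key ha hc hb hac hab (symm hbc) (not_exists.1 h₃))
  obtain ⟨j₁, b₁, a₁, c₁⟩ := h₁
  obtain ⟨j₂, a₂, b₂, c₂⟩ := h₂
  obtain ⟨j₃, a₃, c₃, b₃⟩ := h₃
  refine .inl ⟨a, b, c, j₁, j₂, j₃, ne hab, ne hac, ne hbc, ?_, ?_, ?_,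
    ha, color_eq_none_of_entry ha a₁, hb, color_eq_none_of_entry hb b₂,
    hc, color_eq_none_of_entry hc c₃, a₁, a₂, a₃, b₁, b₂, b₃, c₁, c₂, c₃⟩ <;>
  · rintro rfl
    simp_all

end EnrichedMatrix

/-- Among any three LR-rows of `A`, some two are nested, if and only if `A` contains
none of `D_11`, `D_12`, `D_13` as a subconfiguration. -/
theorem three_LR_rows_two_nested_iff {m n : ℕ} (A : EnrichedMatrix m n) :
    (∀ r₁ r₂ r₃ : Fin m, r₁ ≠ r₂ → r₁ ≠ r₃ → r₂ ≠ r₃ →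
        A.label r₁ = some RowLabel.LR → A.label r₂ = some RowLabel.LR →
        A.label r₃ = some RowLabel.LR →
        A.RowNested r₁ r₂ ∨ A.RowNested r₁ r₃ ∨ A.RowNested r₂ r₃) ↔
      (¬ A.ContainsD11 ∧ ¬ A.ContainsD12 ∧ ¬ A.ContainsD13) := by
  open EnrichedMatrix in
  constructor
  · intro h
    refine ⟨?_, ?_, ?_⟩
    · rintro ⟨a, b, c, j₁, j₂, j₃, hab, hac, hbc, -, -, -, ha, -, hb, -, hc, -,
        a₁, a₂, a₃, b₁, b₂, b₃, c₁, c₂, c₃⟩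
      rcases h a b c hab hac hbc ha hb hc with h | h | h
      · exact not_rowNested_of_entry a₁ b₁ a₂ b₂ h
      · exact not_rowNested_of_entry a₁ c₁ a₃ c₃ h
      · exact not_rowNested_of_entry b₂ c₂ b₃ c₃ h
    · rintro ⟨a, b, c, j₁, j₂, j₃, hab, hac, hbc, -, -, -, ha, -, hb, -, hc, -,
        a₁, a₂, a₃, b₁, b₂, b₃, c₁, c₂, c₃⟩
      rcases h a b c hab hac hbc ha hb hc with h | h | h
      · exact not_rowNested_of_entry a₃ b₃ a₂ b₂ h
      · exact not_rowNested_of_entry a₁ c₁ a₂ c₂ h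
      · exact not_rowNested_of_entry b₁ c₁ b₃ c₃ h
    · rintro ⟨a, b, c, j₁, j₂, j₃, j₄, hab, hac, hbc, -, -, -, -, -, -, ha, -, hb, -, hc, -,
        a₁, a₂, a₃, a₄, b₁, b₂, b₃, b₄, c₁, c₂, c₃, c₄⟩
      rcases h a b c hab hac hbc ha hb hc with h | h | h
      · exact not_rowNested_of_entry a₁ b₁ a₃ b₃ h
      · exact not_rowNested_of_entry a₁ c₁ a₃ c₃ h
      · exact not_rowNested_of_entry b₂ c₂ b₄ c₄ h
  · rintro ⟨h₁, h₂, h₃⟩ a b c - - - ha hb hc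
    by_contra! ⟨hab, hac, hbc⟩
    rcases containsD11_or_containsD12_or_containsD13 ha hb hc hab hac hbc with h | h | h
    exacts [h₁ h, h₂ h, h₃ h]
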